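/- Let d ≥ 1, let ν₁, ν₂ : ℤ^d → [1,∞) be sub-multiplicative, symmetric weights satisfying the GRS condition, and let 𝒜₁ = 𝒞_{ν₁} and 𝒜₂ = 𝒞_{ν₂} be the corresponding Sjöstrand algebras over I₁ = I₂ = ℤ^d. Then 𝒜 = Ã₁ ∩ Ã₂ is inverse-closed: if A ∈ 𝒜 acts as a boundedly invertible operator on ℓ²(ℤ^d×ℤ^d), then the rank-four tensor whose entry B_{i,k,n,m} equals the ((i,k),(m,n)) matrix entry of A⁻¹ also belongs to 𝒜. -/

import Mathlib

open scoped ComplexConjugate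

noncomputable section

namespace PaperTensor

variable {I I₁ I₂ : Type*}

/-- The space `ℓ²(I)`. -/
abbrev L2 (I : Type*) := lp (fun _ : I => ℂ) 2

/-- The continuous linear map `T` represents the matrix `M` as an operator on `ℓ²(I)`,
i.e. `(T c) k = Σ_l M k l * c l` for every `c ∈ ℓ²(I)`. -/
def Represents (M : I → I → ℂ) (T : L2 I →L[ℂ] L2 I) : Prop :=
  ∀ c : L2 I, ∀ k : I, HasSum (fun l : I => M k l * (c : ∀ _ : I, ℂ) l) ((T c : ∀ _ : I, ℂ) k)

/-- `M` defines a bounded operator on `ℓ²(I)`. -/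
def Bounded2 (M : I → I → ℂ) : Prop := ∃ T : L2 I →L[ℂ] L2 I, Represents M T

/-- The operator norm `‖M‖_{B(ℓ²(I))}` of the matrix `M` (junk value `0` if `M` is unbounded). -/
noncomputable def opNorm2 (M : I → I → ℂ) : ℝ :=
  letI : Decidable (Bounded2 M) := Classical.propDecidable _
  if h : Bounded2 M then ‖h.choose‖ else 0

/-- The matrix product of two infinite matrices. -/
noncomputable def matMul (A B : I → I → ℂ) : I → I → ℂ :=
  fun i j => ∑' m : I, A i m * B m j

/-- The conjugate transpose of a matrix. -/
def conjTranspose (A : I → I → ℂ) : I → I → ℂ := fun i j => conj (A j i)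

/-- A solid Banach algebra of (infinite) matrices over the index set `I`. -/
structure SolidBanachAlgebra (I : Type*) where
  carrier : Set (I → I → ℂ)
  anorm : (I → I → ℂ) → ℝ
  zero_mem : (0 : I → I → ℂ) ∈ carrier
  add_mem : ∀ A B : I → I → ℂ, A ∈ carrier → B ∈ carrier → A + B ∈ carrier
  smul_mem : ∀ (c : ℂ) (A : I → I → ℂ), A ∈ carrier → c • A ∈ carrier
  mul_mem : ∀ A B : I → I → ℂ, A ∈ carrier → B ∈ carrier → matMul A B ∈ carrier
  anorm_nonneg : ∀ A ∈ carrier, 0 ≤ anorm A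
  anorm_zero : anorm 0 = 0
  anorm_eq_zero : ∀ A ∈ carrier, anorm A = 0 → A = 0
  anorm_smul : ∀ (c : ℂ), ∀ A ∈ carrier, anorm (c • A) = ‖c‖ * anorm A
  anorm_add : ∀ A ∈ carrier, ∀ B ∈ carrier, anorm (A + B) ≤ anorm A + anorm B
  anorm_mul : ∀ A ∈ carrier, ∀ B ∈ carrier, anorm (matMul A B) ≤ anorm A * anorm B
  complete : ∀ f : ℕ → (I → I → ℂ), (∀ n, f n ∈ carrier) →
      (∀ ε > (0 : ℝ), ∃ N : ℕ, ∀ m ≥ N, ∀ n ≥ N, anorm (f m - f n) < ε) →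
      ∃ A ∈ carrier, ∀ ε > (0 : ℝ), ∃ N : ℕ, ∀ n ≥ N, anorm (f n - A) < ε
  bounded : ∀ A ∈ carrier, Bounded2 A
  solid : ∀ A ∈ carrier, ∀ B : I → I → ℂ,
      (∀ i j, ‖B i j‖ ≤ ‖A i j‖) → B ∈ carrier ∧ anorm B ≤ anorm A

/-- A matrix algebra is involutive if it is closed under conjugate transposition and the
norm is invariant under it. -/
def SolidBanachAlgebra.Involutive (𝒜 : SolidBanachAlgebra I) : Prop :=
  ∀ A ∈ 𝒜.carrier, conjTranspose A ∈ 𝒜.carrier ∧ 𝒜.anorm (conjTranspose A) = 𝒜.anorm A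

/-- Rank-four tensors `(A_{i,k,l,j})` indexed by `I₁ × I₂² × I₁`. -/
abbrev Tensor (I₁ I₂ : Type*) := I₁ → I₂ → I₂ → I₁ → ℂ

/-- The restriction `A|_{{i} × I₂² × {j}}`, an `I₂ × I₂` matrix. -/
def res1 (A : Tensor I₁ I₂) (i j : I₁) : I₂ → I₂ → ℂ := fun k l => A i k l j

/-- The restriction `A|_{I₁ × {(k,l)} × I₁}`, an `I₁ × I₁` matrix. -/
def res2 (A : Tensor I₁ I₂) (k l : I₂) : I₁ → I₁ → ℂ := fun i j => A i k l j

/-- Membership in `Ã₁`, for a set `S` of `I₁ × I₁` matrices playing the role of `𝒜₁`: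
all restrictions `A|_{{i} × I₂² × {j}}` are bounded on `ℓ²(I₂)` and the matrix of their
operator norms belongs to `S`. -/
def MemT1 (S : Set (I₁ → I₁ → ℂ)) (A : Tensor I₁ I₂) : Prop :=
  (∀ i j : I₁, Bounded2 (res1 A i j)) ∧
    (fun i j : I₁ => (opNorm2 (res1 A i j) : ℂ)) ∈ S

/-- Membership in `Ã₂`. -/
def MemT2 (S : Set (I₂ → I₂ → ℂ)) (A : Tensor I₁ I₂) : Prop :=
  (∀ k l : I₂, Bounded2 (res2 A k l)) ∧
    (fun k l : I₂ => (opNorm2 (res2 A k l) : ℂ)) ∈ S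

/-- The norm `‖A‖_{Ã₁}` (meaningful on members of `Ã₁`). -/
noncomputable def normT1 (𝒜₁ : SolidBanachAlgebra I₁) (A : Tensor I₁ I₂) : ℝ :=
  𝒜₁.anorm (fun i j : I₁ => (opNorm2 (res1 A i j) : ℂ))

/-- The norm `‖A‖_{Ã₂}` (meaningful on members of `Ã₂`). -/
noncomputable def normT2 (𝒜₂ : SolidBanachAlgebra I₂) (A : Tensor I₁ I₂) : ℝ :=
  𝒜₂.anorm (fun k l : I₂ => (opNorm2 (res2 A k l) : ℂ))

/-- Membership in `𝒜 = Ã₁ ∩ Ã₂`. -/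
def MemA (𝒜₁ : SolidBanachAlgebra I₁) (𝒜₂ : SolidBanachAlgebra I₂) (A : Tensor I₁ I₂) : Prop :=
  MemT1 𝒜₁.carrier A ∧ MemT2 𝒜₂.carrier A

/-- The norm `‖A‖_𝒜 = max {‖A‖_{Ã₁}, ‖A‖_{Ã₂}}`. -/
noncomputable def normA (𝒜₁ : SolidBanachAlgebra I₁) (𝒜₂ : SolidBanachAlgebra I₂)
    (A : Tensor I₁ I₂) : ℝ :=
  max (normT1 𝒜₁ A) (normT2 𝒜₂ A)

/-- The matrix over `I₁ × I₂` through which a rank-four tensor acts on `ℓ²(I₁ × I₂)`: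
`(Ac)_{(i,k)} = Σ_{(m,n)} A_{i,k,n,m} c_{(m,n)}`. -/
def toMatrix (A : Tensor I₁ I₂) : (I₁ × I₂) → (I₁ × I₂) → ℂ :=
  fun p q => A p.1 p.2 q.2 q.1

/-- The rank-four tensor of matrix entries of an operator `T` on `ℓ²(I₁ × I₂)`:
its `(i,k,l,j)` entry is the `((i,k),(j,l))` matrix entry of `T`. -/
noncomputable def entryTensor (T : L2 (I₁ × I₂) →L[ℂ] L2 (I₁ × I₂)) : Tensor I₁ I₂ :=
  letI : DecidableEq (I₁ × I₂) := Classical.decEq _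
  fun i k l j => (T (lp.single 2 (j, l) (1 : ℂ)) : ∀ _ : I₁ × I₂, ℂ) (i, k)

/-- A set `S` of rank-four tensors is inverse-closed if, whenever `A ∈ S` acts as a boundedly
invertible operator on `ℓ²(I₁ × I₂)`, the rank-four tensor of matrix entries of the inverse
operator also belongs to `S`. -/
def InverseClosed (S : Set (Tensor I₁ I₂)) : Prop :=
  ∀ A ∈ S, ∀ T Tinv : L2 (I₁ × I₂) →L[ℂ] L2 (I₁ × I₂),
    Represents (toMatrix A) T →
    T.comp Tinv = ContinuousLinearMap.id ℂ (L2 (I₁ × I₂)) →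
    Tinv.comp T = ContinuousLinearMap.id ℂ (L2 (I₁ × I₂)) →
    entryTensor Tinv ∈ S

/-- The doubly contracted tensor product
`(A : B)_{i,k,l,j} = Σ_{n ∈ I₂} Σ_{m ∈ I₁} A_{i,k,n,m} B_{m,n,l,j}`. -/
noncomputable def contract (A B : Tensor I₁ I₂) : Tensor I₁ I₂ :=
  fun i k l j => ∑' n : I₂, ∑' m : I₁, A i k n m * B m n l j

/-- Absolute convergence of all series defining the doubly contracted tensor product. -/
def ContractSummable (A B : Tensor I₁ I₂) : Prop :=
  ∀ (i : I₁) (k l : I₂) (j : I₁),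
    Summable (fun nm : I₂ × I₁ => ‖A i k nm.1 nm.2 * B nm.2 nm.1 l j‖)

/-- The adjoint tensor `(A*)_{i,k,l,j} = conj (A_{j,l,k,i})`. -/
def adjT (A : Tensor I₁ I₂) : Tensor I₁ I₂ := fun i k l j => conj (A j l k i)



/-- A subset `I ⊂ ℝ^d` is relatively separated if the number of its points in any cube
`x + [0,1]^d` is uniformly bounded. -/
def RelSeparated {d : ℕ} (I : Set (EuclideanSpace ℝ (Fin d))) : Prop :=
  ∃ N : ℕ, ∀ x : EuclideanSpace ℝ (Fin d),
    (I ∩ {y | ∀ t : Fin d, y t ∈ Set.Icc (x t) (x t + 1)}).Finite ∧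
    (I ∩ {y | ∀ t : Fin d, y t ∈ Set.Icc (x t) (x t + 1)}).ncard ≤ N

/-- The Jaffard algebra `𝒥_s(I)`: matrices with `sup_{i,j} |A_{i,j}| (1+|i-j|)^s < ∞`. -/
def JaffardSet {d : ℕ} (I : Set (EuclideanSpace ℝ (Fin d))) (s : ℝ) :
    Set (↥I → ↥I → ℂ) :=
  {A | ∃ C : ℝ, ∀ i j : ↥I,
    ‖A i j‖ * (1 + ‖(i : EuclideanSpace ℝ (Fin d)) - (j : EuclideanSpace ℝ (Fin d))‖) ^ s ≤ C}

/-- The weighted Schur algebra `𝒮¹_δ(I)`: matrices whose weighted row and column sums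
are uniformly bounded. -/
def SchurSet {d : ℕ} (I : Set (EuclideanSpace ℝ (Fin d))) (δ : ℝ) :
    Set (↥I → ↥I → ℂ) :=
  {A | (∀ i : ↥I, Summable fun j : ↥I =>
          ‖A i j‖ * (1 + ‖(i : EuclideanSpace ℝ (Fin d)) - (j : EuclideanSpace ℝ (Fin d))‖) ^ δ) ∧
       (∀ j : ↥I, Summable fun i : ↥I =>
          ‖A i j‖ * (1 + ‖(i : EuclideanSpace ℝ (Fin d)) - (j : EuclideanSpace ℝ (Fin d))‖) ^ δ) ∧
       ∃ C : ℝ,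
        (∀ i : ↥I, (∑' j : ↥I,
          ‖A i j‖ * (1 + ‖(i : EuclideanSpace ℝ (Fin d)) - (j : EuclideanSpace ℝ (Fin d))‖) ^ δ) ≤ C) ∧
        (∀ j : ↥I, (∑' i : ↥I,
          ‖A i j‖ * (1 + ‖(i : EuclideanSpace ℝ (Fin d)) - (j : EuclideanSpace ℝ (Fin d))‖) ^ δ) ≤ C)}

/-- `ν : ℤ^d → [1,∞)` is an admissible weight: bounded below by `1`, sub-multiplicative,
symmetric, and satisfying the GRS condition. -/
def AdmissibleWeight {d : ℕ} (ν : (Fin d → ℤ) → ℝ) : Prop :=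
  (∀ x, 1 ≤ ν x) ∧
  (∀ x y, ν (x + y) ≤ ν x * ν y) ∧
  (∀ x, ν (-x) = ν x) ∧
  (∀ z : Fin d → ℤ, Filter.Tendsto (fun n : ℕ => (ν (n • z)) ^ ((n : ℝ)⁻¹))
    Filter.atTop (nhds 1))

/-- The Sjöstrand algebra `𝒞_ν` over `ℤ^d`:
matrices with `Σ_i sup_j |A_{j,j-i}| ν(i) < ∞`. -/
def SjostrandSet {d : ℕ} (ν : (Fin d → ℤ) → ℝ) :
    Set ((Fin d → ℤ) → (Fin d → ℤ) → ℂ) :=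
  {A | (∀ i : Fin d → ℤ, BddAbove (Set.range fun j : Fin d → ℤ => ‖A j (j - i)‖)) ∧
       Summable fun i : Fin d → ℤ => (⨆ j : Fin d → ℤ, ‖A j (j - i)‖) * ν i}

section LocalPrinciple

variable {R B G : Type*} [NormedRing R] [NormedAlgebra ℂ R] [CompleteSpace R]

/-- A central element of a complex Banach algebra is scalar modulo every maximal left ideal. -/
theorem exists_sub_algebraMap_mem (L : Ideal R) (hL : L.IsMaximal) (e : R)
    (he : ∀ a, Commute e a) : ∃ z : ℂ, e - algebraMap ℂ R z ∈ L := by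
  have : IsClosed (L : Set R) := hL.isClosed
  have : IsSimpleModule R (R ⧸ L) := isSimpleModule_iff_isCoatom.mpr hL.1
  have : Nontrivial (R ⧸ L) := Submodule.Quotient.nontrivial_iff.mpr hL.ne_top
  let mulE : (R ⧸ L) →ₗ[R] (R ⧸ L) := L.mapQ L (LinearMap.toSpanSingleton R R e) fun a ha => by
    simpa [(he a).eq] using L.mul_mem_left e ha
  let E : (R ⧸ L) →L[ℂ] (R ⧸ L) :=
    { mulE.restrictScalars ℂ with
      cont := by
        refine (L.isQuotientMap_mkQ.continuous_iff).mpr ?_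
        change Continuous fun a : R => L.mkQ (a * e)
        exact L.isQuotientMap_mkQ.continuous.comp (continuous_mul_const e) }
  have : Nontrivial ((R ⧸ L) →L[ℂ] (R ⧸ L)) := inferInstance
  obtain ⟨z, hz⟩ := spectrum.nonempty E
  refine ⟨z, ?_⟩
  let S : (R ⧸ L) →ₗ[R] (R ⧸ L) :=
    L.mapQ L (LinearMap.toSpanSingleton R R (algebraMap ℂ R z - e)) fun a ha => by
      simpa [mul_sub, (he a).eq, ← Algebra.commutes] using
        L.sub_mem (L.mul_mem_left (algebraMap ℂ R z) ha) (L.mul_mem_left e ha)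
  have hS : ∀ x, S x = (algebraMap ℂ ((R ⧸ L) →L[ℂ] (R ⧸ L)) z - E) x := by
    intro x
    obtain ⟨a, rfl⟩ := L.mkQ_surjective x
    change L.mkQ (a * (algebraMap ℂ R z - e)) = z • L.mkQ a - L.mkQ (a * e)
    rw [mul_sub, map_sub, ← Algebra.commutes, ← Algebra.smul_def]
    rfl
  rcases S.bijective_or_eq_zero with h | h
  · refine absurd (ContinuousLinearMap.isUnit_iff_bijective.mpr ?_) hz
    rwa [← funext hS]
  · have h1 : S (L.mkQ 1) = 0 := by rw [h]; rfl
    have h2 : L.mkQ (1 * (algebraMap ℂ R z - e)) = 0 := h1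
    rw [one_mul, Submodule.mkQ_apply, Submodule.Quotient.mk_eq_zero] at h2
    simpa using L.neg_mem h2

theorem norm_le_of_sub_algebraMap_mem {L : Ideal R} (hL : L ≠ ⊤) {e : R} {z : ℂ}
    (h : e - algebraMap ℂ R z ∈ L) : ‖z‖ ≤ ‖e‖ := by
  by_contra! hlt
  have hz : z ≠ 0 := by
    rintro rfl
    simp only [norm_zero] at hlt
    exact absurd (norm_nonneg e) (not_le.mpr hlt)
  have hu : IsUnit (1 - z⁻¹ • e) := by
    apply isUnit_one_sub_of_norm_lt_one
    rw [norm_smul, norm_inv, inv_mul_lt_iff₀ (norm_pos_iff.mpr hz), mul_one]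
    exact hlt
  refine hL (L.eq_top_of_isUnit_mem ?_ hu)
  have := L.mul_mem_left (algebraMap ℂ R (-z⁻¹)) h
  convert this using 1
  rw [mul_sub, ← map_mul, ← Algebra.smul_def, neg_mul, inv_mul_cancel₀ hz, neg_smul]
  simp [sub_eq_add_neg, add_comm]

theorem eq_of_sub_algebraMap_mem {L : Ideal R} (hL : L ≠ ⊤) {e : R} {z w : ℂ}
    (hz : e - algebraMap ℂ R z ∈ L) (hw : e - algebraMap ℂ R w ∈ L) : z = w := by
  have h : (0 : R) - algebraMap ℂ R (z - w) ∈ L := by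
    have := L.sub_mem hz hw
    simpa using this
  have := norm_le_of_sub_algebraMap_mem hL h
  simpa [sub_eq_zero] using this

variable [AddCommGroup G]

/-- A central representation of `G` in a Banach algebra whose growth is dominated by a weight
satisfying the GRS condition acts by a unitary character modulo every maximal left ideal. -/
theorem exists_character (L : Ideal R) (hL : L.IsMaximal) (ν : G → ℝ)
    (hgrs : ∀ z : G, Filter.Tendsto (fun n : ℕ => (ν (n • z)) ^ ((n : ℝ)⁻¹))
      Filter.atTop (nhds 1))
    (τ : G → R) (hτ0 : τ 0 = 1) (hτ : ∀ k l, τ (k + l) = τ k * τ l)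
    (hc : ∀ k a, Commute (τ k) a) (hν : ∀ k, ‖τ k‖ ≤ ν k) :
    ∃ χ : G → ℂ, χ 0 = 1 ∧ (∀ k l, χ (k + l) = χ k * χ l) ∧ (∀ k, ‖χ k‖ = 1) ∧
      ∀ k, τ k - algebraMap ℂ R (χ k) ∈ L := by
  choose χ hχ using fun k => exists_sub_algebraMap_mem L hL (τ k) (hc k)
  have h0 : χ 0 = 1 := eq_of_sub_algebraMap_mem hL.ne_top (hχ 0) (by simp [hτ0])
  have hadd : ∀ k l, χ (k + l) = χ k * χ l := fun k l => by
    refine eq_of_sub_algebraMap_mem hL.ne_top (hχ (k + l)) ?_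
    have := L.add_mem (L.mul_mem_left (τ k) (hχ l)) (L.mul_mem_left (algebraMap ℂ R (χ l)) (hχ k))
    convert this using 1
    rw [hτ, map_mul, mul_sub, mul_sub, ← Algebra.commutes (χ l) (τ k),
      ← Algebra.commutes (χ l) (algebraMap ℂ R (χ k))]
    abel
  have hpow : ∀ (n : ℕ) k, χ (n • k) = χ k ^ n := by
    intro n k
    induction n with
    | zero => simpa using h0
    | succ n ih => rw [succ_nsmul, hadd, ih, pow_succ]
  have hle : ∀ k, ‖χ k‖ ≤ 1 := fun k => by
    refine ge_of_tendsto (hgrs k) ?_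
    filter_upwards [Filter.eventually_gt_atTop 0] with n hn
    have h1 : ‖χ k‖ ^ n ≤ ν (n • k) := by
      rw [← norm_pow, ← hpow]
      exact (norm_le_of_sub_algebraMap_mem hL.ne_top (hχ _)).trans (hν _)
    calc ‖χ k‖ = (‖χ k‖ ^ n) ^ ((n : ℝ)⁻¹) :=
          (Real.pow_rpow_inv_natCast (norm_nonneg _) hn.ne').symm
      _ ≤ _ := Real.rpow_le_rpow (by positivity) h1 (by positivity)
  refine ⟨χ, h0, hadd, fun k => le_antisymm (hle k) ?_, hχ⟩
  have h1 : ‖χ k‖ * ‖χ (-k)‖ = 1 := by rw [← norm_mul, ← hadd, add_neg_cancel, h0, norm_one]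
  nlinarith [hle (-k), norm_nonneg (χ k)]

variable [NormedRing B] [NormedAlgebra ℂ B] [CompleteSpace B]

/-- Noncommutative Wiener lemma: a series `∑ D k • τ k` with coefficients in a Banach algebra is
left invertible as soon as all its evaluations at unitary characters are. -/
theorem exists_left_inverse_tsum (ν : G → ℝ)
    (hgrs : ∀ z : G, Filter.Tendsto (fun n : ℕ => (ν (n • z)) ^ ((n : ℝ)⁻¹))
      Filter.atTop (nhds 1)) (hν1 : ∀ k, 1 ≤ ν k)
    (τ : G → R) (hτ0 : τ 0 = 1) (hτ : ∀ k l, τ (k + l) = τ k * τ l)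
    (hc : ∀ k a, Commute (τ k) a) (hν : ∀ k, ‖τ k‖ ≤ ν k)
    (lam : B →L[ℂ] R) (hlam1 : lam 1 = 1) (hlam : ∀ a b, lam (a * b) = lam a * lam b)
    (D : G → B) (hD : Summable fun k => ‖D k‖ * ν k)
    (hinv : ∀ χ : G → ℂ, χ 0 = 1 → (∀ k l, χ (k + l) = χ k * χ l) → (∀ k, ‖χ k‖ = 1) →
      ∃ b, b * ∑' k, χ k • D k = 1) :
    ∃ Γ, Γ * ∑' k, lam (D k) * τ k = 1 := by
  set F := ∑' k, lam (D k) * τ k with hF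
  have hFs : HasSum (fun k => lam (D k) * τ k) F := by
    refine (Summable.of_norm_bounded (hD.mul_left ‖lam‖) fun k => ?_).hasSum
    refine (norm_mul_le _ _).trans ?_
    rw [← mul_assoc]
    exact mul_le_mul (lam.le_opNorm _) (hν k) (norm_nonneg _) (by positivity)
  suffices h : Ideal.span {F} = ⊤ by
    have : (1 : R) ∈ Ideal.span {F} := by rw [h]; trivial
    exact Ideal.mem_span_singleton'.mp this
  by_contra hne
  obtain ⟨L, hL, hle⟩ := Ideal.exists_le_maximal _ hne
  have hFL : F ∈ L := hle (Ideal.mem_span_singleton_self F)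
  obtain ⟨χ, h0, hadd, hn, hχ⟩ := exists_character L hL ν hgrs τ hτ0 hτ hc hν
  obtain ⟨b, hb⟩ := hinv χ h0 hadd hn
  have hχs : HasSum (fun k => χ k • D k) (∑' k, χ k • D k) := by
    refine (Summable.of_norm_bounded hD fun k => ?_).hasSum
    rw [norm_smul, hn, one_mul]
    exact le_mul_of_one_le_right (norm_nonneg _) (hν1 k)
  have hdiff : F - lam (∑' k, χ k • D k) ∈ L := by
    have hs := hFs.sub (lam.hasSum hχs)
    refine hL.isClosed.mem_of_tendsto hs (Filter.Eventually.of_forall fun s => ?_)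
    refine L.sum_mem fun k _ => ?_
    have := L.mul_mem_left (lam (D k)) (hχ k)
    convert this using 1
    rw [mul_sub, map_smul, Algebra.smul_def, Algebra.commutes]
  have h1 : lam (∑' k, χ k • D k) ∈ L := by simpa using L.sub_mem hFL hdiff
  refine hL.ne_top ((Ideal.eq_top_iff_one L).mpr ?_)
  rw [← hlam1, ← hb, hlam]
  exact L.mul_mem_left _ h1

/-- A version of `exists_left_inverse_tsum` inside the commutant of `τ` and a further family `ρ`. -/
theorem exists_left_inverse_commuting {ι : Type*} (ν : G → ℝ)
    (hgrs : ∀ z : G, Filter.Tendsto (fun n : ℕ => (ν (n • z)) ^ ((n : ℝ)⁻¹))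
      Filter.atTop (nhds 1)) (hν1 : ∀ k, 1 ≤ ν k)
    (τ : G → R) (hτ0 : τ 0 = 1) (hτ : ∀ k l, τ (k + l) = τ k * τ l) (hν : ∀ k, ‖τ k‖ ≤ ν k)
    {lam : B → R} (hadd : ∀ a b, lam (a + b) = lam a + lam b)
    (hsmul : ∀ (z : ℂ) a, lam (z • a) = z • lam a) (hnorm : ∀ b, ‖lam b‖ ≤ ‖b‖)
    (hlam1 : lam 1 = 1) (hlam : ∀ a b, lam (a * b) = lam a * lam b)
    (hlamτ : ∀ b k, lam b * τ k = τ k * lam b)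
    (ρ : ι → R) (hρτ : ∀ b k, ρ b * τ k = τ k * ρ b) (hρlam : ∀ b c, ρ b * lam c = lam c * ρ b)
    (D : G → B) (hD : Summable fun k => ‖D k‖ * ν k)
    (hinv : ∀ χ : G → ℂ, χ 0 = 1 → (∀ k l, χ (k + l) = χ k * χ l) → (∀ k, ‖χ k‖ = 1) →
      ∃ b, b * ∑' k, χ k • D k = 1) :
    ∃ Γ, (∀ k, τ k * Γ = Γ * τ k) ∧ (∀ b, ρ b * Γ = Γ * ρ b) ∧
      HasSum (fun k => Γ * (lam (D k) * τ k)) 1 := by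
  let A : Subalgebra ℂ R := Subalgebra.centralizer ℂ (Set.range τ ∪ Set.range ρ)
  have hAc : IsClosed (A : Set R) := Set.isClosed_centralizer _
  have : CompleteSpace A := hAc.completeSpace_coe
  have hmem : ∀ a : R, (∀ k, τ k * a = a * τ k) → (∀ b, ρ b * a = a * ρ b) → a ∈ A := by
    intro a h h'
    rw [Subalgebra.mem_centralizer_iff]
    rintro _ (⟨k, rfl⟩ | ⟨b, rfl⟩)
    exacts [h k, h' b]
  have hAT : ∀ a ∈ A, ∀ k, τ k * a = a * τ k := fun a ha k =>
    (Subalgebra.mem_centralizer_iff ℂ).mp ha _ (Or.inl ⟨k, rfl⟩)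
  have hAR : ∀ a ∈ A, ∀ b, ρ b * a = a * ρ b := fun a ha b =>
    (Subalgebra.mem_centralizer_iff ℂ).mp ha _ (Or.inr ⟨b, rfl⟩)
  let τA : G → A := fun k =>
    ⟨τ k, hmem _ (fun l => by rw [← hτ, ← hτ, add_comm]) (fun b => hρτ b k)⟩
  let lamL : B →ₗ[ℂ] A :=
    { toFun := fun b => ⟨lam b, hmem _ (fun k => (hlamτ b k).symm) (fun c => hρlam c b)⟩
      map_add' := fun b c => Subtype.ext (hadd b c)
      map_smul' := fun z b => Subtype.ext (hsmul z b) }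
  let lamA : B →L[ℂ] A := lamL.mkContinuous 1 fun b => (hnorm b).trans_eq (one_mul _).symm
  obtain ⟨Γ, hΓ⟩ := exists_left_inverse_tsum ν hgrs hν1 τA (Subtype.ext hτ0)
    (fun k l => Subtype.ext (hτ k l)) (fun k a => Subtype.ext (hAT a a.2 k)) hν lamA
    (Subtype.ext hlam1) (fun a b => Subtype.ext (hlam a b)) D hD hinv
  refine ⟨Γ, hAT _ Γ.2, hAR _ Γ.2, ?_⟩
  have hs : HasSum (fun k => lamA (D k) * τA k) (∑' k, lamA (D k) * τA k) := by
    refine (Summable.of_norm_bounded hD fun k => ?_).hasSum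
    exact (norm_mul_le _ _).trans
      (mul_le_mul (hnorm _) (hν k) (norm_nonneg _) (norm_nonneg _))
  have h2 := hs.mul_left Γ
  rw [hΓ] at h2
  exact h2.map (A.val : A →+* R) continuous_subtype_val

end LocalPrinciple

section Shift

open scoped ENNReal

variable {G X : Type*} [NormedAddCommGroup X] [NormedSpace ℂ X]

theorem memℓp_shift {p : ℝ≥0∞} (hp0 : 0 < p.toReal) (σ : G ≃ G) (φ : G → X →L[ℂ] X) {C : ℝ}
    (hφ : ∀ i, ‖φ i‖ ≤ C) (c : lp (fun _ : G => X) p) :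
    Memℓp (fun i => φ i (c (σ i))) p ∧
      ∑' i, ‖φ i (c (σ i))‖ ^ p.toReal ≤ C ^ p.toReal * ‖c‖ ^ p.toReal := by
  have hs := (σ.hasSum_iff.mpr (lp.hasSum_norm hp0 c)).mul_left (C ^ p.toReal)
  have hle : ∀ i, ‖φ i (c (σ i))‖ ^ p.toReal ≤ C ^ p.toReal * ‖c (σ i)‖ ^ p.toReal := fun i => by
    rw [← Real.mul_rpow ((norm_nonneg _).trans (hφ i)) (norm_nonneg _)]
    exact Real.rpow_le_rpow (norm_nonneg _) ((φ i).le_of_opNorm_le (hφ i) _) hp0.le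
  have hsum : Summable fun i => ‖φ i (c (σ i))‖ ^ p.toReal :=
    hs.summable.of_nonneg_of_le (fun i => by positivity) hle
  exact ⟨memℓp_gen hsum, (hsum.tsum_le_tsum hle hs.summable).trans_eq hs.tsum_eq⟩

theorem exists_lp_shift {p : ℝ≥0∞} [hp1 : Fact (1 ≤ p)] (hp : p ≠ ∞) (σ : G ≃ G)
    (φ : G → X →L[ℂ] X) {C : ℝ} (hC : 0 ≤ C) (hφ : ∀ i, ‖φ i‖ ≤ C) :
    ∃ D : lp (fun _ : G => X) p →L[ℂ] lp (fun _ : G => X) p,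
      (∀ c i, D c i = φ i (c (σ i))) ∧ ‖D‖ ≤ C := by
  have hp0 : 0 < p.toReal := ENNReal.toReal_pos (zero_lt_one.trans_le hp1.out).ne' hp
  let D : lp (fun _ : G => X) p →ₗ[ℂ] lp (fun _ : G => X) p :=
    { toFun := fun c => ⟨fun i => φ i (c (σ i)), (memℓp_shift hp0 σ φ hφ c).1⟩
      map_add' := fun c c' => by ext i; exact map_add (φ i) (c (σ i)) (c' (σ i))
      map_smul' := fun z c => by ext i; exact map_smul (φ i) z (c (σ i)) }
  have hD : ∀ c, ‖D c‖ ≤ C * ‖c‖ := fun c => by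
    refine lp.norm_le_of_tsum_le hp0 (by positivity) ?_
    rw [Real.mul_rpow hC (norm_nonneg _)]
    exact (memℓp_shift hp0 σ φ hφ c).2
  exact ⟨D.mkContinuous C hD, fun _ _ => rfl, D.mkContinuous_norm_le hC hD⟩

end Shift

section Convolution

open scoped ENNReal

/-- The space `ℓ¹(G; B)`. -/
abbrev L1 (G B : Type*) [NormedAddCommGroup B] := lp (fun _ : G => B) 1

variable {G B : Type*} [AddCommGroup G] [NormedRing B] [NormedAlgebra ℂ B] [CompleteSpace B]

/-- Wiener's lemma in the weighted convolution algebra `ℓ¹_ν(G; B)` over a noncommutative Banach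
algebra `B`. -/
theorem exists_convolution_left_inverse [DecidableEq G] (ν : G → ℝ)
    (hgrs : ∀ z : G, Filter.Tendsto (fun n : ℕ => (ν (n • z)) ^ ((n : ℝ)⁻¹))
      Filter.atTop (nhds 1)) (hν1 : ∀ k, 1 ≤ ν k) (hνmul : ∀ k l, ν (k + l) ≤ ν k * ν l)
    (D : G → B) (hD : Summable fun k => ‖D k‖ * ν k)
    (hinv : ∀ χ : G → ℂ, χ 0 = 1 → (∀ k l, χ (k + l) = χ k * χ l) → (∀ k, ‖χ k‖ = 1) →
      ∃ b, b * ∑' k, χ k • D k = 1) :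
    ∃ g : G → B, (Summable fun k => ‖g k‖ * ν k) ∧
      ∀ n, HasSum (fun k => g (n - k) * D k) (if n = 0 then 1 else 0) := by
  have hpos : ∀ k, 0 < ν k := fun k => zero_lt_one.trans_le (hν1 k)
  have h1 : (1 : ℝ≥0∞) ≠ ∞ := ENNReal.one_ne_top
  choose T hTa hTn using fun k : G => exists_lp_shift (X := B) h1 (Equiv.subRight k)
    (fun i => ((ν i / ν (i - k) : ℝ) : ℂ) • ContinuousLinearMap.id ℂ B) (hpos k).le (fun i => by
      refine (ContinuousLinearMap.opNorm_smul_le ((ν i / ν (i - k) : ℝ) : ℂ) _).trans ?_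
      rw [Complex.norm_of_nonneg (div_pos (hpos _) (hpos _)).le]
      refine (mul_le_of_le_one_right (div_pos (hpos _) (hpos _)).le
        ContinuousLinearMap.norm_id_le).trans ?_
      rw [div_le_iff₀ (hpos _)]
      simpa using hνmul k (i - k))
  choose Lm hLa hLn using fun b : B => exists_lp_shift (X := B) h1 (Equiv.refl G)
    (fun _ => ContinuousLinearMap.mul ℂ B b) (norm_nonneg b)
    (fun _ => ContinuousLinearMap.opNorm_mul_apply_le ℂ B b)
  choose Rm hRa hRn using fun b : B => exists_lp_shift (X := B) h1 (Equiv.refl G)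
    (fun _ => (ContinuousLinearMap.mul ℂ B).flip b) (norm_nonneg b) (fun _ =>
      ContinuousLinearMap.opNorm_le_bound _ (norm_nonneg b) fun x => by
        simpa [mul_comm] using norm_mul_le x b)
  simp only [Equiv.subRight_apply, smul_apply, ContinuousLinearMap.id_apply,
    Equiv.refl_apply, ContinuousLinearMap.mul_apply', ContinuousLinearMap.flip_apply]
    at hTa hLa hRa
  have hTadd : ∀ k l, T (k + l) = T k * T l := fun k l => by
    ext x i
    simp only [hTa, mul_apply_eq_comp, smul_smul]
    rw [sub_sub, ← Complex.ofReal_mul, div_mul_div_cancel₀ (hpos _).ne']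
  have hT0 : T 0 = 1 := by
    ext x i
    simp [hTa, (hpos i).ne']
  have hTT : ∀ k l, T k * T l = T l * T k := fun k l => by rw [← hTadd, ← hTadd, add_comm]
  have hRT : ∀ b k, Rm b * T k = T k * Rm b := fun b k => by
    ext x i
    simp [hTa, hRa]
  have hLT : ∀ b k, T k * Lm b = Lm b * T k := fun b k => by
    ext x i
    simp [hTa, hLa]
  have hRL : ∀ b c, Rm b * Lm c = Lm c * Rm b := fun b c => by
    ext x i
    simp [hRa, hLa, mul_assoc]
  obtain ⟨Γ, hΓT, hΓR, hΓ⟩ := exists_left_inverse_commuting ν hgrs hν1 T hT0 hTadd hTn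
    (lam := Lm) (fun b c => by ext x i; simp [hLa, add_mul])
    (fun z b => by
      ext x i
      change Lm (z • b) x i = z • Lm b x i
      simp [hLa])
    hLn (by ext x i; simp [hLa]) (fun a b => by ext x i; simp [hLa, mul_assoc])
    (fun b k => (hLT b k).symm) Rm hRT hRL D hD hinv
  obtain ⟨u, hu⟩ : ∃ u : L1 G B, ∀ i, u i = if i = 0 then (ν 0 : ℂ) • (1 : B) else 0 :=
    ⟨lp.single 1 0 ((ν 0 : ℂ) • (1 : B)), fun i => by
      rw [lp.single_apply, Pi.single_apply]⟩
  have hLR : ∀ b, Lm b u = Rm b u := fun b => by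
    ext i
    rw [hLa, hRa]
    by_cases h : i = 0 <;> simp [hu, h]
  have hsum : ∀ n, HasSum (fun k => (T k (Rm (D k) (Γ u))) n) (u n) := fun n => by
    have h3 := ((lp.evalCLM ℂ (fun _ : G => B) 1 n).comp
      (ContinuousLinearMap.apply ℂ (L1 G B) u)).hasSum hΓ
    have e : ∀ k, T k (Rm (D k) (Γ u)) n = (Γ (Lm (D k) (T k u))) n := fun k => by
      have e1 : Lm (D k) (T k u) = T k (Rm (D k) u) := by
        rw [← hLR]
        exact (DFunLike.congr_fun (hLT (D k) k) u).symm
      rw [e1]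
      have e2 := DFunLike.congr_fun (hΓT k) (Rm (D k) u)
      have e3 := DFunLike.congr_fun (hΓR (D k)) u
      simp only [mul_apply_eq_comp] at e2 e3
      rw [← e2, ← e3]
    simp_rw [e]
    exact h3
  refine ⟨fun k => ((ν k)⁻¹ : ℂ) • (Γ u) k, ?_, fun n => ?_⟩
  · have := lp.hasSum_norm (by simp) (Γ u)
    refine this.summable.congr fun k => ?_
    rw [norm_smul, norm_inv, Complex.norm_of_nonneg (hpos k).le, mul_right_comm,
      inv_mul_cancel₀ (hpos k).ne']
    simp
  · have := (hsum n).const_smul ((ν n)⁻¹ : ℂ)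
    convert this using 1
    · funext k
      rw [hTa, hRa, smul_smul, smul_mul_assoc]
      congr 1
      have : (ν n : ℂ) ≠ 0 := by exact_mod_cast (hpos n).ne'
      push_cast
      field_simp
    · by_cases h : n = 0
      · subst h
        have : (ν 0 : ℂ) ≠ 0 := by exact_mod_cast (hpos 0).ne'
        rw [if_pos rfl, hu, if_pos rfl, smul_smul, inv_mul_cancel₀ this, one_smul]
      · simp [hu, h]

end Convolution

section BlockMatrix

variable {G X : Type*} [NormedAddCommGroup X] [NormedSpace ℂ X] [DecidableEq G]

/-- The space `ℓ²(G; X)`. -/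
abbrev L2V (G X : Type*) [NormedAddCommGroup X] := lp (fun _ : G => X) 2

/-- The `(i, j)` block of an operator on `ℓ²(G; X)`. -/
def blk (T : L2V G X →L[ℂ] L2V G X) (i j : G) : X →L[ℂ] X :=
  (lp.evalCLM ℂ (fun _ : G => X) 2 i).comp
    (T.comp (lp.singleContinuousLinearMap ℂ (fun _ : G => X) 2 j))

theorem blk_apply (T : L2V G X →L[ℂ] L2V G X) (i j : G) (x : X) :
    blk T i j x = T (lp.single 2 j x) i := rfl

theorem norm_blk_le (T : L2V G X →L[ℂ] L2V G X) (i j : G) : ‖blk T i j‖ ≤ ‖T‖ := by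
  refine ContinuousLinearMap.opNorm_le_bound _ (norm_nonneg _) fun x => ?_
  rw [blk_apply]
  refine (lp.norm_apply_le_norm two_ne_zero _ _).trans ((T.le_opNorm _).trans ?_)
  rw [lp.norm_single (by norm_num)]

theorem ext_blk {T S : L2V G X →L[ℂ] L2V G X} (h : ∀ i j x, blk T i j x = blk S i j x) :
    T = S := by
  refine lp.ext_continuousLinearMap ENNReal.ofNat_ne_top fun j => ?_
  ext x i
  exact h i j x

variable [AddCommGroup G] [CompleteSpace X]

theorem tsum_smul_diagonals (T : L2V G X →L[ℂ] L2V G X) (D : G → L2V G X →L[ℂ] L2V G X)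
    (hD : ∀ k i j x, blk (D k) i j x = if i - j = k then blk T i j x else 0)
    (hsum : Summable fun k => ‖D k‖)
    (χ : G → ℂ) (h0 : χ 0 = 1) (hadd : ∀ k l, χ (k + l) = χ k * χ l) (hn : ∀ k, ‖χ k‖ = 1) :
    ∃ U V : L2V G X →L[ℂ] L2V G X, V * U = 1 ∧ U * V = 1 ∧ ∑' k, χ k • D k = U * T * V := by
  have h2 : (2 : ENNReal) ≠ ⊤ := ENNReal.ofNat_ne_top
  have hbound : ∀ k, ‖χ k • ContinuousLinearMap.id ℂ X‖ ≤ 1 := fun k =>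
    (ContinuousLinearMap.opNorm_smul_le _ _).trans (by
      rw [hn, one_mul]; exact ContinuousLinearMap.norm_id_le)
  obtain ⟨U, hU, -⟩ := exists_lp_shift (X := X) h2 (Equiv.refl G)
    (fun i => χ i • ContinuousLinearMap.id ℂ X) zero_le_one hbound
  obtain ⟨V, hV, -⟩ := exists_lp_shift (X := X) h2 (Equiv.refl G)
    (fun i => χ (-i) • ContinuousLinearMap.id ℂ X) zero_le_one (fun i => hbound (-i))
  simp only [Equiv.refl_apply, smul_apply, ContinuousLinearMap.id_apply] at hU hV
  have hinv : ∀ i, χ i * χ (-i) = 1 := fun i => by rw [← hadd, add_neg_cancel, h0]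
  refine ⟨U, V, ?_, ?_, ?_⟩
  · ext x i
    simp [hU, hV, smul_smul, mul_comm (χ (-i)), hinv]
  · ext x i
    simp [hU, hV, smul_smul, hinv]
  · have hs : HasSum (fun k => χ k • D k) (∑' k, χ k • D k) :=
      (Summable.of_norm_bounded hsum fun k => by
        refine (ContinuousLinearMap.opNorm_smul_le _ _).trans ?_
        rw [hn, one_mul]).hasSum
    refine ext_blk fun i j x => ?_
    have hVs : V (lp.single 2 j x) = χ (-j) • lp.single 2 j x := by
      ext i
      rw [hV, lp.coeFn_smul, Pi.smul_apply, lp.single_apply, Pi.single_apply]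
      split_ifs with h
      · rw [h]
      · simp
    have h3 := ((lp.evalCLM ℂ (fun _ : G => X) 2 i).comp
      (ContinuousLinearMap.apply ℂ (L2V G X) (lp.single 2 j x : L2V G X))).hasSum hs
    have h4 : ∀ k, (χ k • D k) (lp.single 2 j x) i =
        if k = i - j then χ k • blk T i j x else 0 := fun k => by
      change χ k • blk (D k) i j x = _
      rw [hD]
      simp only [eq_comm, smul_ite, smul_zero]
    have h5 : HasSum (fun k => if k = i - j then χ k • blk T i j x else 0)
        (blk (∑' k, χ k • D k) i j x) := by
      simp_rw [← h4]
      exact h3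
    have h6 : HasSum (fun k => if k = i - j then χ k • blk T i j x else 0)
        (χ (i - j) • blk T i j x) := by
      have h7 : ∀ k, (if k = i - j then χ k • blk T i j x else 0) =
          if k = i - j then χ (i - j) • blk T i j x else 0 := fun k => by
        split_ifs with h
        · rw [h]
        · rfl
      simp_rw [h7]
      exact hasSum_ite_eq _ _
    rw [h5.unique h6]
    change _ = U (T (V (lp.single 2 j x))) i
    rw [hVs, hU, map_smul, lp.coeFn_smul, Pi.smul_apply, smul_smul, ← hadd, ← sub_eq_add_neg]
    rfl

theorem blk_inverse_bound (ν : G → ℝ)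
    (hgrs : ∀ z : G, Filter.Tendsto (fun n : ℕ => (ν (n • z)) ^ ((n : ℝ)⁻¹))
      Filter.atTop (nhds 1)) (hν1 : ∀ k, 1 ≤ ν k) (hνmul : ∀ k l, ν (k + l) ≤ ν k * ν l)
    (T S : L2V G X →L[ℂ] L2V G X) (hTS : T * S = 1) (hST : S * T = 1)
    (s : G → ℝ) (hs : ∀ i k, ‖blk T i (i - k)‖ ≤ s k) (hsum : Summable fun k => s k * ν k) :
    ∃ s' : G → ℝ, (∀ i k, ‖blk S i (i - k)‖ ≤ s' k) ∧ Summable fun k => s' k * ν k := by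
  have hs0 : ∀ k, 0 ≤ s k := fun k => (norm_nonneg _).trans (hs 0 k)
  choose D hDa hDn using fun k : G => exists_lp_shift (X := X) (p := 2) ENNReal.ofNat_ne_top
    (Equiv.subRight k) (fun i => blk T i (i - k)) (hs0 k) (fun i => hs i k)
  have hD : ∀ k i j x, blk (D k) i j x = if i - j = k then blk T i j x else 0 := fun k i j x => by
    rw [blk_apply, hDa, Equiv.subRight_apply, lp.single_apply, Pi.single_apply]
    by_cases h : i - j = k
    · have h' : i - k = j := by rw [← h]; abel
      rw [if_pos h, if_pos h', h']
    · have h' : i - k ≠ j := by rintro rfl; exact h (by abel)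
      rw [if_neg h, if_neg h', map_zero]
  have hDν : Summable fun k => ‖D k‖ * ν k :=
    hsum.of_nonneg_of_le (fun k => mul_nonneg (norm_nonneg _) (zero_le_one.trans (hν1 k)))
      fun k => mul_le_mul_of_nonneg_right (hDn k) (zero_le_one.trans (hν1 k))
  have hDs : Summable fun k => ‖D k‖ := hDν.of_nonneg_of_le (fun k => norm_nonneg _)
    fun k => le_mul_of_one_le_right (norm_nonneg _) (hν1 k)
  obtain ⟨g, hgν, hg⟩ := exists_convolution_left_inverse ν hgrs hν1 hνmul D hDν
    fun χ h0 hadd hn => by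
      obtain ⟨U, V, hVU, hUV, h⟩ := tsum_smul_diagonals T D hD hDs χ h0 hadd hn
      refine ⟨U * S * V, ?_⟩
      rw [h]
      calc U * S * V * (U * T * V) = U * S * (V * U) * T * V := by simp only [mul_assoc]
        _ = U * (S * T) * V := by rw [hVU, mul_one, mul_assoc U]
        _ = 1 := by rw [hST, mul_one, hUV]
  have hgs : Summable fun k => ‖g k‖ := hgν.of_nonneg_of_le (fun k => norm_nonneg _)
    fun k => le_mul_of_one_le_right (norm_nonneg _) (hν1 k)
  refine ⟨fun k => ‖g k‖, fun i k => ?_, hgν⟩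
  suffices h : ∀ j m, blk S j m = blk (g (j - m)) j m by
    rw [h, sub_sub_cancel]
    exact norm_blk_le _ _ _
  intro j m
  let ev : G → L2V G X →L[ℂ] X := lp.evalCLM ℂ (fun _ : G => X) 2
  have hevn : ∀ l, ‖ev l‖ ≤ 1 := fun l =>
    ContinuousLinearMap.opNorm_le_bound _ zero_le_one fun c => by
      rw [one_mul]; exact lp.norm_apply_le_norm two_ne_zero c l
  let W : G → L2V G X →L[ℂ] X := fun l => (blk (g (j - l)) j l).comp (ev l)
  have hW : HasSum W (∑' l, W l) := by
    refine (Summable.of_norm_bounded ((Equiv.subLeft j).summable_iff.mpr hgs) fun l => ?_).hasSum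
    refine (ContinuousLinearMap.opNorm_comp_le _ _).trans ?_
    exact (mul_le_of_le_one_right (norm_nonneg _) (hevn l)).trans (norm_blk_le _ _ _)
  have hWT : (∑' l, W l).comp T = ev j := by
    refine lp.ext_continuousLinearMap ENNReal.ofNat_ne_top fun m => ?_
    ext x
    change (∑' l, W l) (T (lp.single 2 m x)) = (lp.single 2 m x : L2V G X) j
    have h1 := (ContinuousLinearMap.apply ℂ X (T (lp.single 2 m x))).hasSum hW
    have h2 := ((lp.evalCLM ℂ (fun _ : G => X) 2 j).comp
      (ContinuousLinearMap.apply ℂ (L2V G X) (lp.single 2 m x : L2V G X))).hasSum (hg (j - m))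
    rw [← (Equiv.subRight m).hasSum_iff] at h2
    have h3 : ∀ l, W l (T (lp.single 2 m x)) =
        (g (j - m - (l - m)) * D (l - m)) (lp.single 2 m x) j := fun l => by
      have h4 : D (l - m) (lp.single 2 m x) = lp.single 2 l (blk T l m x) := by
        ext i
        have := hD (l - m) i m x
        rw [blk_apply] at this
        rw [this, lp.single_apply, Pi.single_apply]
        by_cases hil : i = l
        · subst hil; simp
        · rw [if_neg hil, if_neg (by simpa using hil)]
      rw [mul_apply_eq_comp, h4, sub_sub_sub_cancel_right]
      rfl
    have h5 : HasSum (fun l => W l (T (lp.single 2 m x)))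
        ((if j - m = 0 then (1 : L2V G X →L[ℂ] L2V G X) else 0) (lp.single 2 m x) j) := by
      simp_rw [h3]
      exact h2
    refine (HasSum.unique h1 h5).trans ?_
    by_cases h : j - m = 0
    · rw [if_pos h]
      rfl
    · rw [if_neg h, lp.single_apply, Pi.single_apply, if_neg fun e => h (by rw [e, sub_self])]
      rfl
  have hfin : ∑' l, W l = (ev j).comp S := by
    rw [← hWT, ContinuousLinearMap.comp_assoc]
    change _ = (∑' l, W l).comp (T * S)
    rw [hTS]
    rfl
  ext x
  change ev j (S (lp.single 2 m x)) = _
  rw [← ContinuousLinearMap.comp_apply, ← hfin]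
  have h1 := (ContinuousLinearMap.apply ℂ X (lp.single 2 m x : L2V G X)).hasSum hW
  refine h1.unique ?_
  have h2 : ∀ l, W l (lp.single 2 m x) = if l = m then blk (g (j - m)) j m x else 0 := fun l => by
    change blk (g (j - l)) j l ((lp.single 2 m x : L2V G X) l) = _
    rw [lp.single_apply, Pi.single_apply]
    split_ifs with h
    · rw [h]
    · rw [map_zero]
  change HasSum (fun l => W l (lp.single 2 m x)) _
  simp_rw [h2]
  exact hasSum_ite_eq m _

end BlockMatrix

section Transfer

variable {G K J : Type*}

theorem hasSum_sq_norm (c : L2 J) : HasSum (fun j => ‖c j‖ ^ (2 : ℝ)) (‖c‖ ^ (2 : ℝ)) := by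
  simpa using lp.hasSum_norm (p := 2) (by norm_num) c

theorem exists_lp_curry (ψ : G × K ≃ J) :
    ∃ Φ : L2 J ≃ₗᵢ[ℂ] L2V G (L2 K), ∀ c g k, Φ c g k = c (ψ (g, k)) := by
  have hp : 0 < (2 : ENNReal).toReal := by norm_num
  have hsum : ∀ c : L2 J, HasSum (fun x : G × K => ‖c (ψ x)‖ ^ (2 : ℝ)) (‖c‖ ^ (2 : ℝ)) :=
    fun c => ψ.hasSum_iff.mpr (hasSum_sq_norm c)
  have hrow : ∀ (c : L2 J) (g : G), Memℓp (fun k => c (ψ (g, k))) 2 := fun c g => by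
    rw [memℓp_gen_iff hp]
    simpa using (hsum c).summable.prod_factor g
  let row : L2 J → G → L2 K := fun c g => ⟨fun k => c (ψ (g, k)), hrow c g⟩
  have hrows : ∀ c : L2 J, HasSum (fun g => ‖row c g‖ ^ (2 : ℝ)) (‖c‖ ^ (2 : ℝ)) := fun c =>
    (hsum c).prod_fiberwise fun g => hasSum_sq_norm (row c g)
  have hmem : ∀ c : L2 J, Memℓp (row c) 2 := fun c => by
    rw [memℓp_gen_iff hp]
    simpa using (hrows c).summable
  let Φ : L2 J →ₗᵢ[ℂ] L2V G (L2 K) :=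
    { toFun := fun c => ⟨row c, hmem c⟩
      map_add' := fun c e => by ext g k; rfl
      map_smul' := fun a c => by ext g k; rfl
      norm_map' := fun c => by
        have h1 := lp.hasSum_norm (p := 2) hp (⟨row c, hmem c⟩ : L2V G (L2 K))
        have h2 := hrows c
        rw [show (2 : ENNReal).toReal = (2 : ℝ) by norm_num] at h1
        exact (Real.rpow_left_inj (norm_nonneg _) (norm_nonneg _) two_ne_zero).mp (h1.unique h2) }
  have hsurj : Function.Surjective Φ := fun F => by
    have hF : Memℓp (fun j => F (ψ.symm j).1 (ψ.symm j).2) 2 := by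
      rw [memℓp_gen_iff hp, show (2 : ENNReal).toReal = (2 : ℝ) by norm_num]
      refine (ψ.symm.summable_iff (f := fun x : G × K => ‖F x.1 x.2‖ ^ (2 : ℝ))).mpr ?_
      refine (summable_prod_of_nonneg fun x => by positivity).mpr
        ⟨fun g => (hasSum_sq_norm (F g)).summable, ?_⟩
      have h3 : ∀ g, ∑' k, ‖F g k‖ ^ (2 : ℝ) = ‖F g‖ ^ (2 : ℝ) := fun g =>
        (hasSum_sq_norm (F g)).tsum_eq
      simp_rw [h3]
      simpa using (lp.hasSum_norm (p := 2) hp F).summable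
    refine ⟨⟨_, hF⟩, ?_⟩
    ext g k
    change F (ψ.symm (ψ (g, k))).1 (ψ.symm (ψ (g, k))).2 = _
    rw [ψ.symm_apply_apply]
  exact ⟨LinearIsometryEquiv.ofSurjective Φ hsurj, fun c g k => rfl⟩

theorem Represents.unique {M : J → J → ℂ} {T S : L2 J →L[ℂ] L2 J} (hT : Represents M T)
    (hS : Represents M S) : T = S := by
  ext c j
  exact (hT c j).unique (hS c j)

theorem Represents.opNorm2_eq {M : J → J → ℂ} {T : L2 J →L[ℂ] L2 J} (h : Represents M T) :
    opNorm2 M = ‖T‖ := by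
  have hM : Bounded2 M := ⟨T, h⟩
  rw [opNorm2, dif_pos hM, hM.choose_spec.unique h]

theorem represents_entries [DecidableEq J] (T : L2 J →L[ℂ] L2 J) :
    Represents (fun p q => T (lp.single 2 q (1 : ℂ)) p) T := fun c p => by
  have h := ((lp.evalCLM ℂ (fun _ : J => ℂ) 2 p).comp T).hasSum
    (lp.hasSum_single ENNReal.ofNat_ne_top c)
  have e : ∀ q, T (lp.single 2 q (1 : ℂ)) p * c q = T (lp.single 2 q (c q)) p := fun q => by
    rw [show lp.single 2 q (c q) = c q • (lp.single 2 q (1 : ℂ) : L2 J) by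
      rw [← lp.single_smul, smul_eq_mul, mul_one], map_smul, lp.coeFn_smul, Pi.smul_apply,
      smul_eq_mul, mul_comm]
  simp_rw [e]
  exact h

theorem Represents.blk [DecidableEq G] {M : J → J → ℂ} {T : L2 J →L[ℂ] L2 J}
    (hT : Represents M T) {ψ : G × K ≃ J} {Φ : L2 J ≃ₗᵢ[ℂ] L2V G (L2 K)}
    (hΦ : ∀ c g k, Φ c g k = c (ψ (g, k))) (T' : L2V G (L2 K) →L[ℂ] L2V G (L2 K))
    (hT' : ∀ c, T' c = Φ (T (Φ.symm c))) (g h : G) :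
    Represents (fun a b => M (ψ (g, a)) (ψ (h, b))) (blk T' g h) := fun x a => by
  rw [blk_apply, hT', hΦ]
  have hs := hT (Φ.symm (lp.single 2 h x)) (ψ (g, a))
  have hc : ∀ l b, Φ.symm (lp.single 2 h x) (ψ (l, b)) = (lp.single 2 h x : L2V G (L2 K)) l b :=
    fun l b => by rw [← hΦ, Φ.apply_symm_apply]
  have hinj : Function.Injective fun b : K => ψ (h, b) := fun b b' e => by simpa using e
  rw [← hinj.hasSum_iff] at hs
  · have e : ∀ b, M (ψ (g, a)) (ψ (h, b)) * x b = M (ψ (g, a)) (ψ (h, b)) *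
        Φ.symm (lp.single 2 h x) (ψ (h, b)) := fun b => by
      rw [hc, lp.single_apply, Pi.single_eq_same]
    simp_rw [e]
    exact hs
  · intro j hj
    obtain ⟨⟨l, b⟩, rfl⟩ := ψ.surjective j
    have hl : l ≠ h := by
      rintro rfl
      exact hj ⟨b, rfl⟩
    rw [hc, lp.single_apply, Pi.single_eq_of_ne hl]
    exact mul_zero _

/-- Inverse-closedness of the matrices whose blocks have norms in a Sjöstrand algebra. -/
theorem sjostrandSet_inverse {d : ℕ} {ν : (Fin d → ℤ) → ℝ} (hν : AdmissibleWeight ν)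
    (ψ : (Fin d → ℤ) × K ≃ J) {M N : J → J → ℂ} {T S : L2 J →L[ℂ] L2 J}
    (hM : Represents M T) (hN : Represents N S) (hTS : T * S = 1) (hST : S * T = 1)
    (h : (fun g h => (opNorm2 (fun a b => M (ψ (g, a)) (ψ (h, b))) : ℂ)) ∈ SjostrandSet ν) :
    (∀ g h, Bounded2 fun a b => N (ψ (g, a)) (ψ (h, b))) ∧
      (fun g h => (opNorm2 (fun a b => N (ψ (g, a)) (ψ (h, b))) : ℂ)) ∈ SjostrandSet ν := by
  obtain ⟨Φ, hΦ⟩ := exists_lp_curry ψ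
  let conjBy : (L2 J →L[ℂ] L2 J) → L2V (Fin d → ℤ) (L2 K) →L[ℂ] L2V (Fin d → ℤ) (L2 K) :=
    fun R => (Φ.toContinuousLinearEquiv : L2 J →L[ℂ] L2V (Fin d → ℤ) (L2 K)).comp
      (R.comp (Φ.symm.toContinuousLinearEquiv : L2V (Fin d → ℤ) (L2 K) →L[ℂ] L2 J))
  have h_conj : ∀ R c, conjBy R c = Φ (R (Φ.symm c)) := fun R c => rfl
  have hmul : ∀ R R', R * R' = 1 → conjBy R * conjBy R' = 1 := fun R R' e => by
    ext1 c
    rw [mul_apply_eq_comp, h_conj, h_conj, Φ.symm_apply_apply, ← mul_apply_eq_comp R, e]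
    exact Φ.apply_symm_apply c
  have hMb := fun g h => hM.blk hΦ (conjBy T) (h_conj T) g h
  have hNb := fun g h => hN.blk hΦ (conjBy S) (h_conj S) g h
  simp only [SjostrandSet, Set.mem_ofPred_eq, Complex.norm_real, (hMb _ _).opNorm2_eq,
    norm_norm] at h
  obtain ⟨s', hs', hsum'⟩ := blk_inverse_bound ν hν.2.2.2 hν.1 hν.2.1 (conjBy T) (conjBy S)
    (hmul T S hTS) (hmul S T hST) (fun k => ⨆ j, ‖blk (conjBy T) j (j - k)‖)
    (fun i k => le_ciSup (h.1 k) i) h.2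
  refine ⟨fun g h => ⟨_, hNb g h⟩, ?_⟩
  simp only [SjostrandSet, Set.mem_ofPred_eq, Complex.norm_real, (hNb _ _).opNorm2_eq, norm_norm]
  refine ⟨fun k => ⟨s' k, ?_⟩, hsum'.of_nonneg_of_le (fun k => ?_) fun k => ?_⟩
  · rintro _ ⟨j, rfl⟩
    exact hs' j k
  · exact mul_nonneg (Real.iSup_nonneg fun j => norm_nonneg _) (zero_le_one.trans (hν.1 k))
  · exact mul_le_mul_of_nonneg_right (ciSup_le fun j => hs' j k) (zero_le_one.trans (hν.1 k))

end Transfer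

/-- the tensor algebra built from two Sjöstrand algebras over `ℤ^d` is
inverse-closed. -/
theorem statement4 {d : ℕ} (hd : 1 ≤ d)
    (ν₁ ν₂ : (Fin d → ℤ) → ℝ)
    (hν₁ : AdmissibleWeight ν₁) (hν₂ : AdmissibleWeight ν₂) :
    InverseClosed {A : Tensor (Fin d → ℤ) (Fin d → ℤ) |
      MemT1 (SjostrandSet ν₁) A ∧ MemT2 (SjostrandSet ν₂) A} := by
  rintro A ⟨hA₁, hA₂⟩ T S hT hTS hST
  have hS : Represents (toMatrix (entryTensor S)) S :=
    @represents_entries _ (Classical.decEq _) S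
  have h₁ := sjostrandSet_inverse hν₁ (Equiv.refl _) hT hS hTS hST hA₁.2
  have h₂ := sjostrandSet_inverse hν₂ (Equiv.prodComm _ _) hT hS hTS hST hA₂.2
  exact ⟨h₁, h₂⟩

end PaperTensor
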